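/- arXiv:2204.00938 — 8 statements merged into one kernel-verified Lean document; each statement's English description precedes it below -/
import Mathlib

section
/- Let π : E ⥤ B be a functor between categories. Let K : Arrow(E) ⥤ Comma(π, 𝟭_B) be the canonical functor sending a morphism f : e → e' of E to the object (e, π e', π f) and a commutative square (m, n) : f → g to the morphism (m, π n). Then π is a Grothendieck opfibration if and only if K admits a left adjoint L which is a strict section of K (K ∘ L is the identity functor) and for which the unit of the adjunction is the identity natural transformation. (One-categorical Chevalley criterion: cocartesian fibrations via a left adjoint right inverse of the Leibniz cotensor.) -/
open CategoryTheory

universe w v₁ u₁ v₂ u₂ v₃ u₃ v₄ u₄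

section BasicDefs

variable {E : Type u₁} [Category.{v₁} E] {B : Type u₂} [Category.{v₂} B]
  {A : Type u₃} [Category.{v₃} A]

/-- `f` is a `π`-opcartesian morphism. -/
def IsOpcartesianMor (π : E ⥤ B) {e e' : E} (f : e ⟶ e') : Prop :=
  ∀ ⦃e'' : E⦄ (g : e ⟶ e'') (w : π.obj e' ⟶ π.obj e''),
    π.map f ≫ w = π.map g → ∃! h : e' ⟶ e'', π.map h = w ∧ f ≫ h = g

/-- `f` is a `π`-cartesian morphism. -/
def IsCartesianMor (π : E ⥤ B) {e' e : E} (f : e' ⟶ e) : Prop :=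
  ∀ ⦃e'' : E⦄ (g : e'' ⟶ e) (w : π.obj e'' ⟶ π.obj e'),
    w ≫ π.map f = π.map g → ∃! h : e'' ⟶ e', π.map h = w ∧ h ≫ f = g

/-- `f` is `π`-vertical, i.e. `π` sends it to an identity. -/
def IsVerticalMor (π : E ⥤ B) {e e' : E} (f : e ⟶ e') : Prop :=
  ∃ h : π.obj e = π.obj e', π.map f = eqToHom h

/-- `π` is a Grothendieck opfibration. -/
def IsGrothendieckOpfib (π : E ⥤ B) : Prop :=
  ∀ (e : E) ⦃b : B⦄ (u : π.obj e ⟶ b),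
    ∃ (e' : E) (f : e ⟶ e') (hb : π.obj e' = b),
      IsOpcartesianMor π f ∧ π.map f ≫ eqToHom hb = u

/-- `π` is a Grothendieck fibration. -/
def IsGrothendieckFib (π : E ⥤ B) : Prop :=
  ∀ (e : E) ⦃b : B⦄ (v : b ⟶ π.obj e),
    ∃ (e' : E) (f : e' ⟶ e) (hb : π.obj e' = b),
      IsCartesianMor π f ∧ eqToHom hb.symm ≫ π.map f = v

/-- `φ` is a cocartesian fibration sliced over the base of `π`. -/
def IsSlicedCocartFib {F : Type u₄} [Category.{v₄} F] (π : E ⥤ B) (φ : F ⥤ E) : Prop :=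
  ∀ (x : F) (e : E) (k : φ.obj x ⟶ e), IsVerticalMor π k →
    ∃ (x' : F) (f : x ⟶ x') (he : φ.obj x' = e),
      IsOpcartesianMor φ f ∧ φ.map f ≫ eqToHom he = k

/-- The span `⟨ξ,π⟩` is cocartesian on the left. -/
def CocartOnLeft (ξ : E ⥤ A) (π : E ⥤ B) : Prop :=
  ∀ (e : E) ⦃a' : A⦄ (u : ξ.obj e ⟶ a'),
    ∃ (e' : E) (f : e ⟶ e') (ha : ξ.obj e' = a'),
      IsOpcartesianMor ξ f ∧ IsVerticalMor π f ∧ ξ.map f ≫ eqToHom ha = u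

/-- The span `⟨ξ,π⟩` is cartesian on the right. -/
def CartOnRight (ξ : E ⥤ A) (π : E ⥤ B) : Prop :=
  ∀ (e : E) ⦃b' : B⦄ (v : b' ⟶ π.obj e),
    ∃ (e' : E) (f : e' ⟶ e) (hb : π.obj e' = b'),
      IsCartesianMor π f ∧ IsVerticalMor ξ f ∧ eqToHom hb.symm ≫ π.map f = v

/-- `f` and `g` lie over the same arrow of the base (up to `eqToHom`). -/
def OverSameArrow (ξ : E ⥤ A) {x y x' y' : E} (f : x ⟶ y) (g : x' ⟶ y') : Prop :=
  ∃ (p : ξ.obj x = ξ.obj x') (q : ξ.obj y = ξ.obj y'),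
    ξ.map f ≫ eqToHom q = eqToHom p ≫ ξ.map g

/-- Cocartesian and cartesian lifts commute: every comparison morphism
`h : u_!(v^* e) ⟶ v^*(u_! e)` is an isomorphism. -/
def LiftsCommute (ξ : E ⥤ A) (π : E ⥤ B) : Prop :=
  ∀ ⦃e e₁ e₂ e₃ e₄ : E⦄ (k : e ⟶ e₁) (k' : e₂ ⟶ e) (f : e₂ ⟶ e₃) (f' : e₄ ⟶ e₁)
    (g : e₃ ⟶ e₁) (h : e₃ ⟶ e₄),
    IsOpcartesianMor ξ k → IsVerticalMor π k →
    IsCartesianMor π k' → IsVerticalMor ξ k' →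
    IsOpcartesianMor ξ f → IsVerticalMor π f → OverSameArrow ξ f k →
    IsCartesianMor π f' → IsVerticalMor ξ f' → OverSameArrow π f' k' →
    IsVerticalMor ξ g → f ≫ g = k' ≫ k →
    IsVerticalMor ξ h → IsVerticalMor π h → h ≫ f' = g →
    IsIso h

/-- Two-sided (cartesian) fibration. -/
def IsTwoSidedFib (ξ : E ⥤ A) (π : E ⥤ B) : Prop :=
  CocartOnLeft ξ π ∧ CartOnRight ξ π ∧ LiftsCommute ξ π

end BasicDefs

section Statement0

variable {E : Type u₁} [Category.{v₁} E] {B : Type u₂} [Category.{v₂} B]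

/-- The canonical functor `Arrow E ⥤ Comma π (𝟭 B)` sending `f : e ⟶ e'` to
`(e, π e', π f)` and a square `(m, n)` to `(m, π n)`. -/
def chevalleyK (π : E ⥤ B) : Arrow E ⥤ Comma π (𝟭 B) where
  obj f := { left := f.left, right := π.obj f.right, hom := π.map f.hom }
  map {f g} sq :=
    { left := sq.left
      right := π.map sq.right
      w := by
        dsimp
        rw [← π.map_comp, ← π.map_comp]
        congr 1
        simpa using sq.w }

/-- A functor `K` has a left adjoint which is a strict section of `K` with identity unit if and
only if every object of the target is of the form `K.obj Y`, with `Y` having the universal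
property of a free object with identity unit. -/
theorem exists_strictSection_adjunction_iff {C : Type u₃} [Category.{v₃} C]
    {D : Type u₄} [Category.{v₄} D] (K : C ⥤ D) :
    (∃ (L : D ⥤ C) (adj : L ⊣ K) (h : L ⋙ K = 𝟭 D), adj.unit = eqToHom h.symm) ↔
      ∀ X : D, ∃ Y : C, K.obj Y = X ∧
        ∀ ⦃Z : C⦄ (φ : K.obj Y ⟶ K.obj Z), ∃! ψ : Y ⟶ Z, K.map ψ = φ := by
  constructor
  · rintro ⟨L, adj, h, hu⟩ X
    have hX : K.obj (L.obj X) = X := Functor.congr_obj h X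
    have hunit : adj.unit.app X = eqToHom hX.symm := by
      rw [hu, eqToHom_app]
    refine ⟨L.obj X, hX, fun Z φ => ?_⟩
    have key (ψ : L.obj X ⟶ Z) : adj.homEquiv X Z ψ = eqToHom hX.symm ≫ K.map ψ := by
      rw [Adjunction.homEquiv_unit, hunit]
    obtain ⟨ψ, hψ, huniq⟩ := (adj.homEquiv X Z).bijective.existsUnique (eqToHom hX.symm ≫ φ)
    refine ⟨ψ, ?_, fun ψ' hψ' => huniq ψ' ?_⟩
    · rwa [key, cancel_epi] at hψ
    · exact (key ψ').trans (congrArg _ hψ')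
  · intro H
    choose F hF huniv using H
    let e (X : D) (Y : C) : (F X ⟶ Y) ≃ (X ⟶ K.obj Y) :=
      Equiv.ofBijective (fun ψ => eqToHom (hF X).symm ≫ K.map ψ) <| by
        rw [Function.bijective_iff_existsUnique]
        intro φ
        simpa [eqToHom_comp_iff] using huniv X (eqToHom (hF X) ≫ φ)
    have e_apply (X : D) (Y : C) (ψ : F X ⟶ Y) :
        e X Y ψ = eqToHom (hF X).symm ≫ K.map ψ := rfl
    have he (X : D) (Y Y' : C) (g : Y ⟶ Y') (h : F X ⟶ Y) :
        e X Y' (h ≫ g) = e X Y h ≫ K.map g := by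
      simp [e_apply]
    let adj := Adjunction.adjunctionOfEquivLeft e he
    have hunit (X : D) : adj.unit.app X = eqToHom (hF X).symm := by
      simp [adj, e_apply]
    have h : Adjunction.leftAdjointOfEquiv e he ⋙ K = 𝟭 D := by
      refine CategoryTheory.Functor.ext hF fun X X' f => ?_
      have hnat := adj.unit.naturality f
      rw [hunit, hunit] at hnat
      rw [← eqToHom_comp_iff (hF X).symm]
      exact hnat.symm
    refine ⟨_, adj, h, ?_⟩
    ext X
    rw [hunit, eqToHom_app]

/-- A morphism `f` is `π`-opcartesian if and only if every morphism `K f ⟶ K g` comes from a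
unique square `f ⟶ g`, where `K` is `chevalleyK π`. -/
theorem isOpcartesianMor_iff_chevalleyK (π : E ⥤ B) (f : Arrow E) :
    IsOpcartesianMor π f.hom ↔
      ∀ ⦃g : Arrow E⦄ (φ : (chevalleyK π).obj f ⟶ (chevalleyK π).obj g),
        ∃! ψ : f ⟶ g, (chevalleyK π).map ψ = φ := by
  constructor
  · intro hf g φ
    have hφ : π.map φ.left ≫ π.map g.hom = π.map f.hom ≫ φ.right := φ.w
    obtain ⟨n, ⟨hn, hfn⟩, huniq⟩ := hf (φ.left ≫ g.hom) φ.right (hφ.symm.trans (π.map_comp _ _).symm)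
    refine ⟨Arrow.homMk φ.left n hfn.symm, CommaMorphism.ext rfl hn, ?_⟩
    rintro ψ rfl
    exact CommaMorphism.ext rfl (huniq ψ.right ⟨rfl, (Arrow.w ψ).symm⟩)
  · intro H e'' g w hw
    let φ : (chevalleyK π).obj f ⟶ (chevalleyK π).obj (Arrow.mk g) :=
      { left := 𝟙 f.left
        right := w
        w := by simpa [chevalleyK] using hw.symm }
    obtain ⟨ψ, hψ, huniq⟩ := H φ
    have hleft : ψ.left = 𝟙 f.left := congrArg CommaMorphism.left hψ
    have hright : π.map ψ.right = w := congrArg CommaMorphism.right hψ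
    refine ⟨ψ.right, ⟨hright, ?_⟩, ?_⟩
    · have := Arrow.w ψ
      rw [hleft] at this
      exact this.symm.trans (Category.id_comp g)
    · rintro n ⟨hn, hfn⟩
      have hn' : Arrow.homMk (f := f) (g := Arrow.mk g) (𝟙 f.left) n
          ((Category.id_comp g).trans hfn.symm) = ψ :=
        huniq _ (CommaMorphism.ext rfl hn)
      exact congrArg CommaMorphism.right hn'

/-- `π` is a Grothendieck opfibration if and only if every object of the comma category is
strictly the image under `chevalleyK π` of an opcartesian morphism. -/
theorem isGrothendieckOpfib_iff_exists_chevalleyK_obj_eq (π : E ⥤ B) :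
    IsGrothendieckOpfib π ↔
      ∀ X : Comma π (𝟭 B), ∃ f : Arrow E,
        (chevalleyK π).obj f = X ∧ IsOpcartesianMor π f.hom := by
  constructor
  · rintro H ⟨e, b, u⟩
    change π.obj e ⟶ b at u
    obtain ⟨e', f, hb, hf, hu⟩ := H e u
    subst hb hu
    exact ⟨Arrow.mk f, by simp [chevalleyK], hf⟩
  · intro H e b u
    have lift (X : Comma π (𝟭 B)) : ∃ (e' : E) (f : X.left ⟶ e') (hb : π.obj e' = X.right),
        IsOpcartesianMor π f ∧ π.map f ≫ eqToHom hb = X.hom := by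
      obtain ⟨f, rfl, hf⟩ := H X
      exact ⟨f.right, f.hom, rfl, hf, Category.comp_id _⟩
    exact lift { left := e, right := b, hom := u }

/-- **One-categorical Chevalley criterion.** A functor `π : E ⥤ B` is a Grothendieck
opfibration if and only if the canonical functor `K : Arrow E ⥤ Comma π (𝟭 B)` admits
a left adjoint `L` which is a strict section of `K` and whose adjunction unit is the
identity natural transformation. -/
theorem isGrothendieckOpfib_iff_chevalley (π : E ⥤ B) :
    IsGrothendieckOpfib π ↔
      ∃ (L : Comma π (𝟭 B) ⥤ Arrow E) (adj : L ⊣ chevalleyK π)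
        (h : L ⋙ chevalleyK π = 𝟭 (Comma π (𝟭 B))),
        adj.unit = eqToHom h.symm := by
  simp only [isGrothendieckOpfib_iff_exists_chevalleyK_obj_eq,
    exists_strictSection_adjunction_iff, isOpcartesianMor_iff_chevalleyK]

end Statement0
end

section
/- Let π : E ⥤ B be a functor, let ∂ : Comma(π, 𝟭_B) ⥤ B be the projection (e,b,u) ↦ b, and let ι : E ⥤ Comma(π, 𝟭_B) be the functor e ↦ (e, π e, id). Then π is a Grothendieck opfibration if and only if ι admits a left adjoint τ with π ∘ τ = ∂ such that the unit of the adjunction is sent to the identity natural transformation by ∂ and the counit is sent to the identity natural transformation by π (i.e., τ is a fibered left adjoint of ι over B). (One-categorical form of the characterization of cocartesian fibrations via a fibered transport adjoint.) -/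
open CategoryTheory

universe w v₁ u₁ v₂ u₂ v₃ u₃ v₄ u₄

section Statement1

variable {E : Type u₁} [Category.{v₁} E] {B : Type u₂} [Category.{v₂} B]

/-- The canonical inclusion `ι : E ⥤ Comma π (𝟭 B)`, `e ↦ (e, π e, id)`. -/
def slicedIota (π : E ⥤ B) : E ⥤ Comma π (𝟭 B) where
  obj e := { left := e, right := π.obj e, hom := 𝟙 _ }
  map f := { left := f, right := π.map f, w := by simp }

theorem map_left_of_hom_slicedIota {π : E ⥤ B} {X : Comma π (𝟭 B)} {Y : E}
    (k : X ⟶ (slicedIota π).obj Y) :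
    π.map (X := X.left) (Y := Y) k.left = CategoryStruct.comp (Z := π.obj Y) X.hom k.right :=
  (Category.comp_id _).symm.trans k.w

/-- Maps out of the target of an opcartesian morphism `f` over `X.hom` correspond to maps
from `X` to the objects in the image of `slicedIota π`. -/
noncomputable def IsOpcartesianMor.commaHomEquiv {π : E ⥤ B} {X : Comma π (𝟭 B)} {e' : E}
    {f : X.left ⟶ e'} (hf : IsOpcartesianMor π f) (hb : π.obj e' = X.right)
    (hu : π.map f ≫ eqToHom hb = X.hom) (Y : E) :
    (e' ⟶ Y) ≃ (X ⟶ (slicedIota π).obj Y) :=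
  Equiv.ofBijective
    (fun h =>
      { left := f ≫ h
        right := eqToHom hb.symm ≫ π.map h
        w := by simp [slicedIota, ← hu] })
    (by
      refine ⟨fun h h' hh => ?_, fun k => ?_⟩
      · have hl : f ≫ h = f ≫ h' := congrArg CommaMorphism.left hh
        have hr : eqToHom hb.symm ≫ π.map h = eqToHom hb.symm ≫ π.map h' :=
          congrArg CommaMorphism.right hh
        exact (hf (f ≫ h') (π.map h') (by simp)).unique ⟨(cancel_epi _).1 hr, hl⟩ ⟨rfl, rfl⟩
      · obtain ⟨h, ⟨hw, hg⟩, -⟩ := hf (e'' := Y) k.left (eqToHom hb ≫ k.right) (by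
          rw [map_left_of_hom_slicedIota, ← hu]
          exact (Category.assoc _ _ _).symm)
        exact ⟨h, CommaMorphism.ext hg ((eqToHom_comp_iff _ _ _).2 hw)⟩)

theorem IsOpcartesianMor.map_commaHomEquiv_symm {π : E ⥤ B} {X : Comma π (𝟭 B)} {e' : E}
    {f : X.left ⟶ e'} (hf : IsOpcartesianMor π f) (hb : π.obj e' = X.right)
    (hu : π.map f ≫ eqToHom hb = X.hom) {Y : E} (k : X ⟶ (slicedIota π).obj Y) :
    π.map ((hf.commaHomEquiv hb hu Y).symm k) = eqToHom hb ≫ k.right :=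
  (eqToHom_comp_iff _ _ _).1
    (congrArg CommaMorphism.right ((hf.commaHomEquiv hb hu Y).apply_symm_apply k))

/-- The components of a unit exhibiting a left adjoint of `slicedIota π` are opcartesian as
soon as their images in the base are isomorphisms. -/
theorem isOpcartesianMor_unit_left {π : E ⥤ B} {τ : Comma π (𝟭 B) ⥤ E}
    (adj : τ ⊣ slicedIota π) (X : Comma π (𝟭 B)) [IsIso (adj.unit.app X).right] :
    IsOpcartesianMor π (e := X.left) (e' := τ.obj X) (adj.unit.app X).left := by
  intro Y g w hw
  let k : X ⟶ (slicedIota π).obj Y :=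
    { left := g
      right := (adj.unit.app X).right ≫ w
      w := by
        refine (Category.comp_id _).trans (hw.symm.trans ?_)
        rw [map_left_of_hom_slicedIota]
        exact Category.assoc _ _ _ }
  have hk : ∀ h : τ.obj X ⟶ Y, adj.unit.app X ≫ (slicedIota π).map h = k ↔
      π.map h = w ∧ (adj.unit.app X).left ≫ h = g := by
    intro h
    constructor
    · intro hh
      exact ⟨(cancel_epi (adj.unit.app X).right).1 (congrArg CommaMorphism.right hh),
        congrArg CommaMorphism.left hh⟩
    · rintro ⟨rfl, rfl⟩
      rfl
  refine ⟨(adj.homEquiv X Y).symm k, (hk _).1 ?_, fun h hh => ?_⟩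
  · exact (adj.homEquiv_unit ..).symm.trans ((adj.homEquiv X Y).apply_symm_apply k)
  · rw [Equiv.eq_symm_apply, adj.homEquiv_unit]
    exact (hk h).2 hh

/-- **Cocartesian fibrations via a fibered transport adjoint.** `π : E ⥤ B` is a
Grothendieck opfibration iff `ι : E ⥤ Comma π (𝟭 B)` admits a left adjoint `τ` with
`π ∘ τ = ∂` (where `∂ = Comma.snd π (𝟭 B)` is the projection `(e,b,u) ↦ b`), such
that `∂` sends the unit to the identity natural transformation and `π` sends the
counit to the identity natural transformation. -/
theorem isGrothendieckOpfib_iff_fiberedTransport (π : E ⥤ B) :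
    IsGrothendieckOpfib π ↔
      ∃ (τ : Comma π (𝟭 B) ⥤ E) (adj : τ ⊣ slicedIota π),
        τ ⋙ π = Comma.snd π (𝟭 B) ∧
        (∀ X : Comma π (𝟭 B), IsVerticalMor (Comma.snd π (𝟭 B)) (adj.unit.app X)) ∧
        (∀ e : E, IsVerticalMor π (adj.counit.app e)) := by
  constructor
  · intro H
    choose obj lift hb hlift hu using fun X : Comma π (𝟭 B) => H X.left X.hom
    let φ : ∀ X Y, (obj X ⟶ Y) ≃ (X ⟶ (slicedIota π).obj Y) := fun X Y =>
      (hlift X).commaHomEquiv (hb X) (hu X) Y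
    have hφ : ∀ X Y Y' (g : Y ⟶ Y') (h : obj X ⟶ Y),
        φ X Y' (h ≫ g) = φ X Y h ≫ (slicedIota π).map g := by
      intro X Y Y' g h
      apply CommaMorphism.ext
      · exact (Category.assoc _ _ _).symm
      · exact (congrArg (eqToHom (hb X).symm ≫ ·) (π.map_comp h g)).trans
          (Category.assoc _ _ _).symm
    have hφ_id : ∀ X, (φ X (obj X) (𝟙 _)).right = eqToHom (hb X).symm := fun X =>
      (congrArg (eqToHom (hb X).symm ≫ ·) (π.map_id _)).trans (Category.comp_id _)
    refine ⟨Adjunction.leftAdjointOfEquiv φ hφ, Adjunction.adjunctionOfEquivLeft φ hφ,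
      ?_, ?_, ?_⟩
    · refine CategoryTheory.Functor.ext hb fun X Y k => ?_
      refine ((hlift X).map_commaHomEquiv_symm (hb X) (hu X) _).trans ?_
      exact congrArg (fun t => eqToHom (hb X) ≫ k.right ≫ t) (hφ_id Y)
    · intro X
      refine ⟨(hb X).symm, ?_⟩
      rw [Adjunction.adjunctionOfEquivLeft_unit_app]
      exact hφ_id X
    · intro e
      refine ⟨hb ((slicedIota π).obj e), ?_⟩
      rw [Adjunction.adjunctionOfEquivLeft_counit_app]
      exact ((hlift _).map_commaHomEquiv_symm (hb _) (hu _) _).trans (Category.comp_id _)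
  · rintro ⟨τ, adj, -, hunit, -⟩ e b u
    let X : Comma π (𝟭 B) := { left := e, right := b, hom := u }
    obtain ⟨hb, hη⟩ := hunit X
    change (adj.unit.app X).right = eqToHom hb at hη
    have : IsIso (adj.unit.app X).right := by rw [hη]; infer_instance
    refine ⟨τ.obj X, (adj.unit.app X).left, hb.symm, isOpcartesianMor_unit_left adj X, ?_⟩
    refine (comp_eqToHom_iff _ _ _).2 ((map_left_of_hom_slicedIota _).trans ?_)
    rw [hη]
    rfl

end Statement1
end

section
/- Let ξ : F ⥤ B and π : E ⥤ B be Grothendieck opfibrations and let φ : F ⥤ E be a functor with π ∘ φ = ξ that sends ξ-opcartesian morphisms to π-opcartesian morphisms. Then φ is a Grothendieck opfibration if and only if φ is a cocartesian fibration sliced over B (i.e., every π-vertical morphism φ x → e admits a φ-opcartesian lift with domain x). -/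
open CategoryTheory

universe w v₁ u₁ v₂ u₂ v₃ u₃ v₄ u₄

section Statement3

variable {F : Type u₁} [Category.{v₁} F] {E : Type u₂} [Category.{v₂} E]
  {B : Type u₃} [Category.{v₃} B]

/-- Opcartesian morphisms are closed under composition. -/
theorem IsOpcartesianMor.comp {φ : F ⥤ E} {x y z : F} {f : x ⟶ y} {f' : y ⟶ z}
    (hf : IsOpcartesianMor φ f) (hf' : IsOpcartesianMor φ f') :
    IsOpcartesianMor φ (f ≫ f') := by
  intro t g w hw
  rw [φ.map_comp, Category.assoc] at hw
  obtain ⟨h, ⟨hh, hfh⟩, hu⟩ := hf g (φ.map f' ≫ w) hw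
  obtain ⟨k, ⟨hk, hfk⟩, hu'⟩ := hf' h w hh.symm
  refine ⟨k, ⟨hk, by rw [Category.assoc, hfk, hfh]⟩, ?_⟩
  rintro k' ⟨hk', hfk'⟩
  refine hu' k' ⟨hk', hu _ ⟨by rw [φ.map_comp, hk'], ?_⟩⟩
  rw [← hfk', Category.assoc]

/-- An opcartesian morphism for `φ ⋙ π` whose image under `φ` is `π`-opcartesian is
`φ`-opcartesian. -/
theorem IsOpcartesianMor.of_comp {φ : F ⥤ E} {π : E ⥤ B} {x y : F} {f : x ⟶ y}
    (hf : IsOpcartesianMor (φ ⋙ π) f) (hφf : IsOpcartesianMor π (φ.map f)) :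
    IsOpcartesianMor φ f := by
  intro t g w hw
  have hw' : π.map (φ.map f) ≫ π.map w = π.map (φ.map g) := by rw [← π.map_comp, hw]
  obtain ⟨h, ⟨hh, hfh⟩, hu⟩ := hf g (π.map w) hw'
  refine ⟨h, ⟨?_, hfh⟩, ?_⟩
  · exact (hφf (φ.map g) (π.map w) hw').unique ⟨hh, by rw [← φ.map_comp, hfh]⟩ ⟨rfl, hw⟩
  · rintro h' ⟨hh', hfh'⟩
    exact hu h' ⟨congrArg π.map hh', hfh'⟩

/-- Let `ξ : F ⥤ B` and `π : E ⥤ B` be Grothendieck opfibrations and `φ : F ⥤ E` a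
functor with `π ∘ φ = ξ` sending `ξ`-opcartesian morphisms to `π`-opcartesian
morphisms. Then `φ` is a Grothendieck opfibration iff it is a cocartesian fibration
sliced over `B`. -/
theorem isGrothendieckOpfib_iff_slicedCocartFib
    (ξ : F ⥤ B) (π : E ⥤ B) (φ : F ⥤ E) (hcomp : φ ⋙ π = ξ)
    (hξ : IsGrothendieckOpfib ξ) (hπ : IsGrothendieckOpfib π)
    (hpres : ∀ ⦃x y : F⦄ (f : x ⟶ y), IsOpcartesianMor ξ f → IsOpcartesianMor π (φ.map f)) :
    IsGrothendieckOpfib φ ↔ IsSlicedCocartFib π φ := by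
  subst hcomp
  refine ⟨fun h x e k _ => h x k, fun h x b u => ?_⟩
  obtain ⟨x₁, f, hb, hf, hfu⟩ := hξ x (π.map u)
  have hφf := hpres f hf
  obtain ⟨k, ⟨hk, hfk⟩, -⟩ := hφf u (eqToHom hb) hfu
  obtain ⟨x₂, f', he, hf', hfk'⟩ := h x₁ b k ⟨hb, hk⟩
  exact ⟨x₂, f ≫ f', he, (hf.of_comp hφf).comp hf', by
    rw [φ.map_comp, Category.assoc, hfk', hfk]⟩

end Statement3
end

section
/- Let ξ : F ⥤ B, π : E ⥤ B and ρ : G ⥤ B be functors, and let φ : F ⥤ E and ψ : E ⥤ G satisfy π ∘ φ = ξ and ρ ∘ ψ = π. If φ is a cocartesian fibration sliced over B (with respect to ξ and π) and ψ is a cocartesian fibration sliced over B (with respect to π and ρ), then the composite ψ ∘ φ is a cocartesian fibration sliced over B (with respect to ξ and ρ). -/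
open CategoryTheory

universe w v₁ u₁ v₂ u₂ v₃ u₃ v₄ u₄

section Statement5

variable {F : Type u₁} [Category.{v₁} F] {E : Type u₂} [Category.{v₂} E]
  {G : Type u₃} [Category.{v₃} G] {B : Type u₄} [Category.{v₄} B]

/-- If `φ f` is `ψ`-opcartesian and `f` is `φ`-opcartesian, then `f` is
`φ ⋙ ψ`-opcartesian. -/
theorem IsOpcartesianMor.comp_functor {φ : F ⥤ E} {ψ : E ⥤ G} {x x' : F} {f : x ⟶ x'}
    (hf : IsOpcartesianMor φ f) (hφf : IsOpcartesianMor ψ (φ.map f)) :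
    IsOpcartesianMor (φ ⋙ ψ) f := by
  intro x'' g w hw
  obtain ⟨h, ⟨hψ, hcomp⟩, huniq⟩ := hφf (φ.map g) w hw
  obtain ⟨l, ⟨hφ, hl⟩, hluniq⟩ := hf g h hcomp
  refine ⟨l, ⟨by simp [hφ, hψ], hl⟩, fun m ⟨hmw, hm⟩ => hluniq m ⟨?_, hm⟩⟩
  exact huniq _ ⟨hmw, by rw [← φ.map_comp, hm]⟩

/-- **Composition of sliced cocartesian fibrations.** If `φ : F ⥤ E` is a cocartesian
fibration sliced over `B` (w.r.t. `ξ` and `π`) and `ψ : E ⥤ G` is a cocartesian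
fibration sliced over `B` (w.r.t. `π` and `ρ`), then `ψ ∘ φ` is a cocartesian
fibration sliced over `B` (w.r.t. `ξ` and `ρ`). -/
theorem isSlicedCocartFib_comp
    (ξ : F ⥤ B) (π : E ⥤ B) (ρ : G ⥤ B) (φ : F ⥤ E) (ψ : E ⥤ G)
    (hφξ : φ ⋙ π = ξ) (hψπ : ψ ⋙ ρ = π)
    (hφ : IsSlicedCocartFib π φ) (hψ : IsSlicedCocartFib ρ ψ) :
    IsSlicedCocartFib ρ (φ ⋙ ψ) := by
  subst hψπ
  intro x g k hk
  obtain ⟨e, f, rfl, hf, rfl⟩ := hψ (φ.obj x) g k hk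
  have hfv : IsVerticalMor (ψ ⋙ ρ) f := by simpa [IsVerticalMor] using hk
  obtain ⟨x', l, rfl, hl, rfl⟩ := hφ x e f hfv
  simp only [eqToHom_refl, Category.comp_id] at hf
  exact ⟨x', l, rfl, hl.comp_functor hf, by simp⟩

end Statement5
end

section
/- Let I be an index type and, for each i : I, let ξ_i : F_i ⥤ B_i, π_i : E_i ⥤ B_i and φ_i : F_i ⥤ E_i be functors with π_i ∘ φ_i = ξ_i. If each φ_i is a cocartesian fibration sliced over B_i, then the product functor ∏_i φ_i : ∏_i F_i ⥤ ∏_i E_i (with respect to the product functors ∏_i ξ_i and ∏_i π_i to ∏_i B_i) is a cocartesian fibration sliced over ∏_i B_i. Moreover, if in addition each ξ_i and π_i is a Grothendieck fibration and each φ_i sends ξ_i-cartesian morphisms to π_i-cartesian morphisms, then ∏_i ξ_i and ∏_i π_i are Grothendieck fibrations and ∏_i φ_i sends (∏_i ξ_i)-cartesian morphisms to (∏_i π_i)-cartesian morphisms. -/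
open CategoryTheory

universe w v₁ u₁ v₂ u₂ v₃ u₃ v₄ u₄ v₅ u₅ v₆ u₆

section CartesianMor

variable {E : Type u₁} [Category.{v₁} E] {B : Type u₂} [Category.{v₂} B]

theorem IsCartesianMor.hom_ext {π : E ⥤ B} {x y z : E} {f : x ⟶ y} (hf : IsCartesianMor π f)
    {h k : z ⟶ x} (hπ : π.map h = π.map k) (hcomp : h ≫ f = k ≫ f) : h = k :=
  (hf (k ≫ f) (π.map k) (π.map_comp k f).symm).unique ⟨hπ, hcomp⟩ ⟨rfl, rfl⟩

/-- Precomposing a cartesian morphism with an isomorphism yields a cartesian morphism. -/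
theorem IsCartesianMor.iso_comp {π : E ⥤ B} {x y z : E} {f : x ⟶ y} (hf : IsCartesianMor π f)
    (h : z ≅ x) : IsCartesianMor π (h.hom ≫ f) := by
  intro e'' g w hw
  obtain ⟨k, ⟨hk₁, hk₂⟩, hk₃⟩ := hf g (w ≫ π.map h.hom) (by simpa using hw)
  refine ⟨k ≫ h.inv, ⟨by simp [hk₁, ← π.map_comp], by simpa using hk₂⟩, ?_⟩
  rintro l ⟨hl₁, hl₂⟩
  rw [Iso.eq_comp_inv]
  exact hk₃ _ ⟨by simp [hl₁], by simpa using hl₂⟩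

/-- Two cartesian morphisms over the same arrow differ by an isomorphism of their domains. -/
theorem IsCartesianMor.exists_iso {π : E ⥤ B} {x x' y : E} {f : x ⟶ y} {f' : x' ⟶ y}
    (hf : IsCartesianMor π f) (hf' : IsCartesianMor π f') (p : π.obj x = π.obj x')
    (hp : eqToHom p ≫ π.map f' = π.map f) : ∃ h : x ≅ x', h.hom ≫ f' = f := by
  obtain ⟨h, ⟨hh₁, hh₂⟩, -⟩ := hf' f (eqToHom p) hp
  obtain ⟨k, ⟨hk₁, hk₂⟩, -⟩ := hf f' (eqToHom p.symm) (by simp [← hp])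
  exact ⟨⟨h, k, hf.hom_ext (by simp [hh₁, hk₁]) (by simp [hh₂, hk₂]),
    hf'.hom_ext (by simp [hh₁, hk₁]) (by simp [hh₂, hk₂])⟩, hh₂⟩

end CartesianMor

section Pi

variable {I : Type w} {E : I → Type u₁} [∀ i, Category.{v₁} (E i)]
  {B : I → Type u₂} [∀ i, Category.{v₂} (B i)]

theorem isOpcartesianMor_pi {π : ∀ i, E i ⥤ B i} {x y : ∀ i, E i} {f : x ⟶ y}
    (hf : ∀ i, IsOpcartesianMor (π i) (f i)) : IsOpcartesianMor (Functor.pi π) f := by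
  intro z g w hw
  choose h hh hu using fun i => hf i (g i) (w i) (congrFun hw i)
  exact ⟨h, ⟨funext fun i => (hh i).1, funext fun i => (hh i).2⟩, fun k hk =>
    funext fun i => hu i (k i) ⟨congrFun hk.1 i, congrFun hk.2 i⟩⟩

theorem isCartesianMor_pi {π : ∀ i, E i ⥤ B i} {x y : ∀ i, E i} {f : x ⟶ y}
    (hf : ∀ i, IsCartesianMor (π i) (f i)) : IsCartesianMor (Functor.pi π) f := by
  intro z g w hw
  choose h hh hu using fun i => hf i (g i) (w i) (congrFun hw i)
  exact ⟨h, ⟨funext fun i => (hh i).1, funext fun i => (hh i).2⟩, fun k hk =>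
    funext fun i => hu i (k i) ⟨congrFun hk.1 i, congrFun hk.2 i⟩⟩

theorem IsVerticalMor.apply {π : ∀ i, E i ⥤ B i} {x y : ∀ i, E i} {f : x ⟶ y}
    (hf : IsVerticalMor (Functor.pi π) f) (i : I) : IsVerticalMor (π i) (f i) := by
  obtain ⟨h, hfh⟩ := hf
  exact ⟨congrFun h i, (congrFun hfh i).trans (Functor.eqToHom_proj h i)⟩

/-- A family of cartesian lifts assembles to a cartesian lift in the product. -/
theorem exists_isCartesianMor_pi {π : ∀ i, E i ⥤ B i} (hπ : ∀ i, IsGrothendieckFib (π i))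
    (e : ∀ i, E i) {b : ∀ i, B i} (v : b ⟶ (Functor.pi π).obj e) :
    ∃ (e' : ∀ i, E i) (f : e' ⟶ e) (hb : (Functor.pi π).obj e' = b),
      (∀ i, IsCartesianMor (π i) (f i)) ∧ eqToHom hb.symm ≫ (Functor.pi π).map f = v := by
  choose e' f hb hf hv using fun i => hπ i (e i) (v i)
  refine ⟨e', f, funext hb, hf, funext fun i => ?_⟩
  rw [Pi.comp_apply, Functor.eqToHom_proj]
  exact hv i

theorem isGrothendieckFib_pi {π : ∀ i, E i ⥤ B i} (hπ : ∀ i, IsGrothendieckFib (π i)) :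
    IsGrothendieckFib (Functor.pi π) := by
  intro e b v
  obtain ⟨e', f, hb, hf, hv⟩ := exists_isCartesianMor_pi hπ e v
  exact ⟨e', f, hb, isCartesianMor_pi hf, hv⟩

/-- The components of a cartesian morphism of a product of fibrations are cartesian. -/
theorem IsCartesianMor.apply {π : ∀ i, E i ⥤ B i} (hπ : ∀ i, IsGrothendieckFib (π i))
    {x y : ∀ i, E i} {f : x ⟶ y} (hf : IsCartesianMor (Functor.pi π) f) (i : I) :
    IsCartesianMor (π i) (f i) := by
  obtain ⟨x', f', hb, hf', hv⟩ := exists_isCartesianMor_pi hπ y ((Functor.pi π).map f)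
  obtain ⟨h, rfl⟩ := hf.exists_iso (isCartesianMor_pi hf') hb.symm hv
  exact (hf' i).iso_comp ((Pi.eval E i).mapIso h)

theorem IsSlicedCocartFib.pi {F : I → Type u₃} [∀ i, Category.{v₃} (F i)]
    {π : ∀ i, E i ⥤ B i} {φ : ∀ i, F i ⥤ E i} (hφ : ∀ i, IsSlicedCocartFib (π i) (φ i)) :
    IsSlicedCocartFib (Functor.pi π) (Functor.pi φ) := by
  intro x e k hk
  choose x' f he hf hfk using fun i => hφ i (x i) (e i) (k i) (hk.apply i)
  refine ⟨x', f, funext he, isOpcartesianMor_pi hf, funext fun i => ?_⟩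
  rw [Pi.comp_apply, Functor.eqToHom_proj]
  exact hfk i

end Pi

section Statement6

variable {I : Type w} {F : I → Type u₁} [∀ i, Category.{v₁} (F i)]
  {E : I → Type u₂} [∀ i, Category.{v₂} (E i)]
  {B : I → Type u₃} [∀ i, Category.{v₃} (B i)]

/-- **Products of sliced cocartesian fibrations.** If each `φ i : F i ⥤ E i` is a
cocartesian fibration sliced over `B i`, then `∏ᵢ φᵢ` is a cocartesian fibration
sliced over `∏ᵢ Bᵢ`; moreover if each `ξ i` and `π i` is a Grothendieck fibration
and each `φ i` preserves cartesian morphisms, then the product functors are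
Grothendieck fibrations and `∏ᵢ φᵢ` preserves cartesian morphisms. -/
theorem isSlicedCocartFib_pi
    (ξ : ∀ i, F i ⥤ B i) (π : ∀ i, E i ⥤ B i) (φ : ∀ i, F i ⥤ E i)
    (hcomp : ∀ i, φ i ⋙ π i = ξ i)
    (hsl : ∀ i, IsSlicedCocartFib (π i) (φ i)) :
    IsSlicedCocartFib (Functor.pi π) (Functor.pi φ) ∧
    ((∀ i, IsGrothendieckFib (ξ i)) → (∀ i, IsGrothendieckFib (π i)) →
      (∀ i, ∀ ⦃x y : F i⦄ (f : x ⟶ y),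
        IsCartesianMor (ξ i) f → IsCartesianMor (π i) ((φ i).map f)) →
      IsGrothendieckFib (Functor.pi ξ) ∧ IsGrothendieckFib (Functor.pi π) ∧
      (∀ ⦃x y : ∀ i, F i⦄ (f : x ⟶ y),
        IsCartesianMor (Functor.pi ξ) f →
        IsCartesianMor (Functor.pi π) ((Functor.pi φ).map f))) := by
  refine ⟨IsSlicedCocartFib.pi hsl, fun hξ hπ hφ =>
    ⟨isGrothendieckFib_pi hξ, isGrothendieckFib_pi hπ, fun x y f hf => ?_⟩⟩
  exact isCartesianMor_pi fun i => hφ i (f i) (hf.apply hξ i)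

end Statement6
end

section
/- Let ⟨ξ,π⟩ : E ⥤ A × B be a span that is cocartesian on the left and cartesian on the right, with chosen lifts k(u,e) : e → u_! e (π-vertical ξ-opcartesian over u) and k'(v,e) : v^* e → e (ξ-vertical π-cartesian over v). Fix u : a → a', v : b' → b and an object e with ξ e = a and π e = b, and set k := k(u,e), k' := k'(v,e), f := k(u, v^* e) : v^* e → u_!(v^* e), f' := k'(v, u_! e) : v^*(u_! e) → u_! e. Let g : u_!(v^* e) → u_! e be the unique morphism with ξ g = id and g ∘ f = k ∘ k' (which exists by ξ-opcartesianness of f), and let g' : v^* e → v^*(u_! e) be the unique morphism with π g' = id and f' ∘ g' = k ∘ k' (by π-cartesianness of f'). Then the unique morphism h : u_!(v^* e) → v^*(u_! e) with f' ∘ h = g, ξ h = id and π h = id (by π-cartesianness of f') coincides with the unique morphism h' : u_!(v^* e) → v^*(u_! e) with h' ∘ f = g' (by ξ-opcartesianness of f). (Comparing cartesian and cocartesian transport.) -/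
open CategoryTheory

universe w v₁ u₁ v₂ u₂ v₃ u₃ v₄ u₄ v₅ u₅ v₆ u₆

section Statement8

variable {E : Type u₁} [Category.{v₁} E] {A : Type u₂} [Category.{v₂} A]
  {B : Type u₃} [Category.{v₃} B]

/-- **Comparing cartesian and cocartesian transport.** Let `⟨ξ,π⟩ : E ⥤ A × B` be a
span that is cocartesian on the left and cartesian on the right. Given
`k : e ⟶ u_! e` (a `π`-vertical `ξ`-opcartesian lift), `k' : v^* e ⟶ e` (a
`ξ`-vertical `π`-cartesian lift), `f : v^* e ⟶ u_!(v^* e)` and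
`f' : v^*(u_! e) ⟶ u_! e` lifts of the same `u` resp. `v`, let `g` be the unique
`ξ`-vertical morphism with `g ∘ f = k ∘ k'` and `g'` the unique `π`-vertical
morphism with `f' ∘ g' = k ∘ k'`. Then the unique bivertical `h` with `f' ∘ h = g`
coincides with the unique `ξ`-vertical `h'` with `h' ∘ f = g'`. -/
theorem comparison_transport_eq
    (ξ : E ⥤ A) (π : E ⥤ B)
    (hco : CocartOnLeft ξ π) (hca : CartOnRight ξ π)
    -- the chosen lifts `k : e ⟶ u_! e` and `k' : v^* e ⟶ e`
    ⦃e e₁ e₂ e₃ e₄ : E⦄ (k : e ⟶ e₁) (k' : e₂ ⟶ e)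
    (hk_op : IsOpcartesianMor ξ k) (hk_vert : IsVerticalMor π k)
    (hk'_cart : IsCartesianMor π k') (hk'_vert : IsVerticalMor ξ k')
    -- `f := k(u, v^* e) : v^* e ⟶ u_!(v^* e)`, a lift of the same `u` as `k`
    (f : e₂ ⟶ e₃)
    (hf_op : IsOpcartesianMor ξ f) (hf_vert : IsVerticalMor π f)
    (hf_over : OverSameArrow ξ f k)
    -- `f' := k'(v, u_! e) : v^*(u_! e) ⟶ u_! e`, a lift of the same `v` as `k'`
    (f' : e₄ ⟶ e₁)
    (hf'_cart : IsCartesianMor π f') (hf'_vert : IsVerticalMor ξ f')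
    (hf'_over : OverSameArrow π f' k')
    -- `g : u_!(v^* e) ⟶ u_! e`, the unique morphism with `ξ g = id`, `g ∘ f = k ∘ k'`
    (g : e₃ ⟶ e₁) (hg_vert : IsVerticalMor ξ g) (hg : f ≫ g = k' ≫ k)
    -- `g' : v^* e ⟶ v^*(u_! e)`, the unique morphism with `π g' = id`, `f' ∘ g' = k ∘ k'`
    (g' : e₂ ⟶ e₄) (hg'_vert : IsVerticalMor π g') (hg' : g' ≫ f' = k' ≫ k)
    -- `h`, the unique morphism with `f' ∘ h = g`, `ξ h = id`, `π h = id`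
    (h : e₃ ⟶ e₄) (hh_ξ : IsVerticalMor ξ h) (hh_π : IsVerticalMor π h)
    (hh : h ≫ f' = g)
    -- `h'`, the unique (fill) morphism with `h' ∘ f = g'`
    (h' : e₃ ⟶ e₄) (hh'_ξ : IsVerticalMor ξ h') (hh' : f ≫ h' = g') :
    h = h' := by
  obtain ⟨_, hf_eq⟩ := hf_vert
  obtain ⟨_, hg'_eq⟩ := hg'_vert
  obtain ⟨_, hh_eq⟩ := hh_π
  obtain ⟨_, hh_eq'⟩ := hh_ξ
  obtain ⟨_, hh'_eq⟩ := hh'_ξ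
  have hfh : f ≫ h = g' :=
    (hf'_cart (g' ≫ f') (π.map g') (π.map_comp g' f').symm).unique
      ⟨by rw [π.map_comp, hf_eq, hh_eq, hg'_eq, eqToHom_trans],
        by rw [Category.assoc, hh, hg, hg']⟩ ⟨rfl, rfl⟩
  exact (hf_op (f ≫ h') (ξ.map h') (ξ.map_comp f h').symm).unique
    ⟨hh_eq'.trans hh'_eq.symm, hfh.trans hh'.symm⟩ ⟨rfl, rfl⟩

end Statement8
end

section
/- Let ⟨ξ,π⟩ : E ⥤ A × B be a span that is cocartesian on the left and cartesian on the right, with chosen lifts k(u,e) : e → u_! e and k'(v,e) : v^* e → e. The following are equivalent: (i) for all u : a → a', v : b' → b and all objects e over (a,b), the comparison morphism h(u,v,e) : u_!(v^* e) → v^*(u_! e) is an isomorphism; (ii) for all such u, v, e and every commutative square g ∘ f = k(u,e) ∘ k'(v,e), where f : v^* e → d satisfies ξ f = u and π f = id, and g : d → u_! e satisfies ξ g = id and π g = v, the morphism f is ξ-opcartesian if and only if g is π-cartesian. (Commutation of cocartesian and cartesian lifts.) -/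
open CategoryTheory

universe w v₁ u₁ v₂ u₂ v₃ u₃ v₄ u₄ v₅ u₅ v₆ u₆

namespace IsVerticalMor

variable {E : Type u₁} [Category.{v₁} E] {B : Type u₂} [Category.{v₂} B] {π : E ⥤ B}

theorem comp {x y z : E} {f : x ⟶ y} {g : y ⟶ z} (hf : IsVerticalMor π f)
    (hg : IsVerticalMor π g) : IsVerticalMor π (f ≫ g) := by
  obtain ⟨p, hp⟩ := hf
  obtain ⟨q, hq⟩ := hg
  exact ⟨p.trans q, by simp [hp, hq]⟩

/-- Vertical morphisms satisfy left cancellation. -/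
theorem of_comp_right {x y z : E} {f : x ⟶ y} {g : y ⟶ z} (hg : IsVerticalMor π g)
    (hfg : IsVerticalMor π (f ≫ g)) : IsVerticalMor π f := by
  obtain ⟨q, hq⟩ := hg
  obtain ⟨r, hr⟩ := hfg
  refine ⟨r.trans q.symm, ?_⟩
  rw [Functor.map_comp, hq, comp_eqToHom_iff, eqToHom_trans] at hr
  exact hr

theorem map_eq {x y : E} {f g : x ⟶ y} (hf : IsVerticalMor π f) (hg : IsVerticalMor π g) :
    π.map f = π.map g := by
  obtain ⟨_, hp⟩ := hf
  obtain ⟨_, hq⟩ := hg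
  rw [hp, hq]

theorem isIso_map {x y : E} {f : x ⟶ y} (hf : IsVerticalMor π f) : IsIso (π.map f) := by
  obtain ⟨_, hp⟩ := hf
  rw [hp]
  infer_instance

/-- In a commutative square with two opposite vertical sides, the other two sides lie over
the same arrow. -/
theorem overSameArrow_of_square {x y z t : E} {f : x ⟶ y} {g : y ⟶ t} {k' : x ⟶ z}
    {k : z ⟶ t} (hf : IsVerticalMor π f) (hk : IsVerticalMor π k) (sq : f ≫ g = k' ≫ k) :
    OverSameArrow π g k' := by
  obtain ⟨p, hp⟩ := hf
  obtain ⟨q, hq⟩ := hk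
  refine ⟨p.symm, q.symm, ?_⟩
  have := congrArg π.map sq
  rw [Functor.map_comp, Functor.map_comp, hp, hq, eqToHom_comp_iff] at this
  simp [this]

end IsVerticalMor

namespace IsCartesianMor

variable {E : Type u₁} [Category.{v₁} E] {B : Type u₂} [Category.{v₂} B] {π : E ⥤ B}

theorem hom_ext_s9 {x y z : E} {f : y ⟶ z} (hf : IsCartesianMor π f) {a b : x ⟶ y}
    (hπ : π.map a = π.map b) (h : a ≫ f = b ≫ f) : a = b :=
  (hf (b ≫ f) (π.map b) (π.map_comp b f).symm).unique ⟨hπ, h⟩ ⟨rfl, rfl⟩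

theorem isIso_comp {x y z : E} {f : y ⟶ z} (hf : IsCartesianMor π f) (h : x ⟶ y) [IsIso h] :
    IsCartesianMor π (h ≫ f) := by
  intro t g w hw
  obtain ⟨l, ⟨hl, hlg⟩, -⟩ := hf g (w ≫ π.map h) (by simpa using hw)
  refine ⟨l ≫ inv h, ⟨by simp [hl], by simp [hlg]⟩, ?_⟩
  rintro m ⟨rfl, hm⟩
  rw [IsIso.eq_comp_inv]
  exact hf.hom_ext_s9 (by simp [hl]) (by simp [hm, hlg])

/-- A morphism between cartesian morphisms with the same target is invertible as soon as its
image in the base is. -/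
theorem isIso_of_comp {x y z : E} {f : y ⟶ z} {h : x ⟶ y} (hf : IsCartesianMor π f)
    (hhf : IsCartesianMor π (h ≫ f)) [IsIso (π.map h)] : IsIso h := by
  obtain ⟨j, ⟨hj, hjf⟩, -⟩ := hhf f (inv (π.map h)) (by simp)
  exact ⟨j, hhf.hom_ext_s9 (by simp [hj]) (by simp [hjf]),
    hf.hom_ext_s9 (by simp [hj]) (by simpa using hjf)⟩

end IsCartesianMor

namespace IsOpcartesianMor

variable {E : Type u₁} [Category.{v₁} E] {B : Type u₂} [Category.{v₂} B] {π : E ⥤ B}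

theorem hom_ext_s9 {x y z : E} {f : x ⟶ y} (hf : IsOpcartesianMor π f) {a b : y ⟶ z}
    (hπ : π.map a = π.map b) (h : f ≫ a = f ≫ b) : a = b :=
  (hf (f ≫ b) (π.map b) (π.map_comp f b).symm).unique ⟨hπ, h⟩ ⟨rfl, rfl⟩

theorem comp_isIso {x y z : E} {f : x ⟶ y} (hf : IsOpcartesianMor π f) (h : y ⟶ z) [IsIso h] :
    IsOpcartesianMor π (f ≫ h) := by
  intro t g w hw
  obtain ⟨l, ⟨hl, hlg⟩, -⟩ := hf g (π.map h ≫ w) (by simpa using hw)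
  refine ⟨inv h ≫ l, ⟨by simp [hl], by simp [hlg]⟩, ?_⟩
  rintro m ⟨rfl, hm⟩
  rw [IsIso.eq_inv_comp]
  exact hf.hom_ext_s9 (by simp [hl]) (by simpa [hlg] using hm)

end IsOpcartesianMor

section Spans

variable {E : Type u₁} [Category.{v₁} E] {A : Type u₂} [Category.{v₂} A]
  {B : Type u₃} [Category.{v₃} B] {ξ : E ⥤ A} {π : E ⥤ B}

/-- The comparison of `g` with a cartesian morphism over the same arrow. -/
theorem IsCartesianMor.exists_vertical_comp_eq {x y z t s : E} {f : y ⟶ z} {g : x ⟶ z}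
    {k : t ⟶ s} (hf : IsCartesianMor π f) (hfξ : IsVerticalMor ξ f) (hgξ : IsVerticalMor ξ g)
    (hfk : OverSameArrow π f k) (hgk : OverSameArrow π g k) :
    ∃ h : x ⟶ y, IsVerticalMor ξ h ∧ IsVerticalMor π h ∧ h ≫ f = g := by
  obtain ⟨p, q, hp⟩ := hfk
  obtain ⟨p', q', hp'⟩ := hgk
  have hw : eqToHom (p'.trans p.symm) ≫ π.map f = π.map g := by
    rw [comp_eqToHom_iff] at hp hp'
    simp [hp, hp']
  obtain ⟨h, ⟨hh, hhf⟩, -⟩ := hf g _ hw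
  exact ⟨h, hfξ.of_comp_right (hhf ▸ hgξ), ⟨_, hh⟩, hhf⟩

theorem CocartOnLeft.exists_square (hco : CocartOnLeft ξ π) {e e₁ e₂ : E} (k : e ⟶ e₁)
    {k' : e₂ ⟶ e} (hk' : IsVerticalMor ξ k') :
    ∃ (e₃ : E) (f : e₂ ⟶ e₃) (g : e₃ ⟶ e₁), IsOpcartesianMor ξ f ∧ IsVerticalMor π f ∧
      OverSameArrow ξ f k ∧ IsVerticalMor ξ g ∧ f ≫ g = k' ≫ k := by
  obtain ⟨p, hp⟩ := hk'
  obtain ⟨e₃, f, q, hf, hfπ, hfk⟩ := hco e₂ (eqToHom p ≫ ξ.map k)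
  obtain ⟨g, ⟨hg, sq⟩, -⟩ := hf (k' ≫ k) (eqToHom q) (by simp [hfk, hp])
  exact ⟨e₃, f, g, hf, hfπ, ⟨p, q, hfk⟩, ⟨q, hg⟩, sq⟩

theorem CartOnRight.exists_lift (hca : CartOnRight ξ π) {e e₁ e₂ : E} {k : e ⟶ e₁}
    (hk : IsVerticalMor π k) (k' : e₂ ⟶ e) :
    ∃ (e₄ : E) (f' : e₄ ⟶ e₁), IsCartesianMor π f' ∧ IsVerticalMor ξ f' ∧
      OverSameArrow π f' k' := by
  obtain ⟨q, -⟩ := hk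
  obtain ⟨e₄, f', p, hf', hf'ξ, hfk⟩ := hca e₁ (π.map k' ≫ eqToHom q)
  rw [eqToHom_comp_iff] at hfk
  exact ⟨e₄, f', hf', hf'ξ, p, q.symm, by simp [hfk]⟩

end Spans

section Statement9

variable {E : Type u₁} [Category.{v₁} E] {A : Type u₂} [Category.{v₂} A]
  {B : Type u₃} [Category.{v₃} B]

/-- **Commutation of cocartesian and cartesian lifts.** For a span `⟨ξ,π⟩ : E ⥤ A × B`
that is cocartesian on the left and cartesian on the right, the following are
equivalent: (i) every comparison morphism `u_!(v^* e) ⟶ v^*(u_! e)` is an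
isomorphism; (ii) in every commutative square `g ∘ f = k ∘ k'` as in the statement,
`f` is `ξ`-opcartesian iff `g` is `π`-cartesian. -/
theorem liftsCommute_iff_opcartesian_iff_cartesian
    (ξ : E ⥤ A) (π : E ⥤ B)
    (hco : CocartOnLeft ξ π) (hca : CartOnRight ξ π) :
    LiftsCommute ξ π ↔
      (∀ ⦃e e₁ e₂ d : E⦄ (k : e ⟶ e₁) (k' : e₂ ⟶ e) (f : e₂ ⟶ d) (g : d ⟶ e₁),
        IsOpcartesianMor ξ k → IsVerticalMor π k →
        IsCartesianMor π k' → IsVerticalMor ξ k' →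
        OverSameArrow ξ f k → IsVerticalMor π f →
        IsVerticalMor ξ g → OverSameArrow π g k' →
        f ≫ g = k' ≫ k →
        (IsOpcartesianMor ξ f ↔ IsCartesianMor π g)) := by
  constructor
  · intro hlc e e₁ e₂ d k k' f g hk hkπ hk' hk'ξ hfk hfπ hgξ hgk sq
    constructor
    · intro hf
      obtain ⟨e₄, f', hf', hf'ξ, hf'k⟩ := hca.exists_lift hkπ k'
      obtain ⟨h, hhξ, hhπ, rfl⟩ := hf'.exists_vertical_comp_eq hf'ξ hgξ hf'k hgk
      have := hlc k k' f f' _ h hk hkπ hk' hk'ξ hf hfπ hfk hf' hf'ξ hf'k hgξ sq hhξ hhπ rfl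
      exact hf'.isIso_comp h
    · intro hg
      obtain ⟨e₃, f₀, g₀, hf₀, hf₀π, hf₀k, hg₀ξ, sq₀⟩ := hco.exists_square k hk'ξ
      obtain ⟨h, hhξ, hhπ, rfl⟩ := hg.exists_vertical_comp_eq hgξ hg₀ξ hgk
        (hf₀π.overSameArrow_of_square hkπ sq₀)
      have := hlc k k' f₀ g _ h hk hkπ hk' hk'ξ hf₀ hf₀π hf₀k hg hgξ hgk hg₀ξ sq₀ hhξ hhπ rfl
      have hfh : f₀ ≫ h = f :=
        hg.hom_ext_s9 ((hf₀π.comp hhπ).map_eq hfπ) (by simpa [sq] using sq₀)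
      exact hfh ▸ hf₀.comp_isIso h
  · rintro hiff e e₁ e₂ e₃ e₄ k k' f f' _ h hk hkπ hk' hk'ξ hf hfπ hfk hf' - - hgξ sq - hhπ rfl
    have hg := (hiff k k' f _ hk hkπ hk' hk'ξ hfk hfπ hgξ
      (hfπ.overSameArrow_of_square hkπ sq) sq).1 hf
    have := hhπ.isIso_map
    exact hf'.isIso_of_comp hg

end Statement9
end

section
/- Let I be an index type and, for each i : I, let ⟨ξ_i, π_i⟩ : E_i ⥤ A_i × B_i be a two-sided fibration. Then the product span ⟨∏_i ξ_i, ∏_i π_i⟩ : ∏_i E_i ⥤ (∏_i A_i) × (∏_i B_i) is a two-sided fibration, and for each j : I the projection ∏_i E_i ⥤ E_j, together with the projections ∏_i A_i ⥤ A_j and ∏_i B_i ⥤ B_j, is a two-sided cartesian functor. (Product stability of two-sided fibrations.) -/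
open CategoryTheory

universe w v₁ u₁ v₂ u₂ v₃ u₃ v₄ u₄ v₅ u₅ v₆ u₆

section Statement14

/-- A two-sided cartesian functor between spans, over base functors `j` and `l`. -/
def IsTwoSidedCartFunctor
    {E : Type u₁} [Category.{v₁} E] {A : Type u₂} [Category.{v₂} A]
    {B : Type u₃} [Category.{v₃} B]
    {E' : Type u₄} [Category.{v₄} E'] {A' : Type u₅} [Category.{v₅} A']
    {B' : Type u₆} [Category.{v₆} B']
    (ξ : E ⥤ A) (π : E ⥤ B) (ξ' : E' ⥤ A') (π' : E' ⥤ B')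
    (j : A ⥤ A') (l : B ⥤ B') (Φ : E ⥤ E') : Prop :=
  ξ ⋙ j = Φ ⋙ ξ' ∧ π ⋙ l = Φ ⋙ π' ∧
  (∀ ⦃x y : E⦄ (f : x ⟶ y), IsOpcartesianMor ξ f → IsOpcartesianMor ξ' (Φ.map f)) ∧
  (∀ ⦃x y : E⦄ (f : x ⟶ y), IsCartesianMor π f → IsCartesianMor π' (Φ.map f))

variable {I : Type w} {E : I → Type u₁} [∀ i, Category.{v₁} (E i)]
  {A : I → Type u₂} [∀ i, Category.{v₂} (A i)]
  {B : I → Type u₃} [∀ i, Category.{v₃} (B i)]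

theorem isVerticalMor_pi_iff {ξ : ∀ i, E i ⥤ A i} {x y : ∀ i, E i} {f : x ⟶ y} :
    IsVerticalMor (Functor.pi ξ) f ↔ ∀ i, IsVerticalMor (ξ i) (f i) := by
  constructor
  · rintro ⟨h, hf⟩ i
    exact ⟨congrFun h i, (congrFun hf i).trans (Functor.eqToHom_proj h i)⟩
  · intro H
    choose h hf using H
    exact ⟨funext h, funext fun i => (hf i).trans (Functor.eqToHom_proj (funext h) i).symm⟩

theorem OverSameArrow.apply {ξ : ∀ i, E i ⥤ A i} {x y x' y' : ∀ i, E i}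
    {f : x ⟶ y} {g : x' ⟶ y'} (H : OverSameArrow (Functor.pi ξ) f g) (i : I) :
    OverSameArrow (ξ i) (f i) (g i) := by
  obtain ⟨p, q, h⟩ := H
  refine ⟨congrFun p i, congrFun q i, ?_⟩
  have hi := congrFun h i
  rw [Pi.comp_apply, Pi.comp_apply, Functor.eqToHom_proj, Functor.eqToHom_proj] at hi
  exact hi

theorem existsUnique_apply {α : I → Type*} {P : ∀ i, α i → Prop}
    (H : ∃! h : ∀ i, α i, ∀ i, P i (h i)) (i : I) : ∃! a : α i, P i a := by
  classical
  obtain ⟨h, hP, hu⟩ := H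
  refine ⟨h i, hP i, fun a ha => ?_⟩
  have key := hu (Function.update h i a) fun k => by
    obtain rfl | hk := eq_or_ne k i
    · rwa [Function.update_self]
    · rw [Function.update_of_ne hk]
      exact hP k
  rw [← key, Function.update_self]

theorem isOpcartesianMor_pi_iff {ξ : ∀ i, E i ⥤ A i} {x y : ∀ i, E i} {f : x ⟶ y} :
    IsOpcartesianMor (Functor.pi ξ) f ↔ ∀ i, IsOpcartesianMor (ξ i) (f i) := by
  classical
  constructor
  · intro H i z g w hw
    let T (k : I) := Σ' (z : E k) (g : x k ⟶ z) (w : (ξ k).obj (y k) ⟶ (ξ k).obj z),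
      (ξ k).map (f k) ≫ w = (ξ k).map g
    let D : ∀ k, T k :=
      Function.update (fun k => ⟨y k, f k, 𝟙 _, Category.comp_id _⟩) i ⟨z, g, w, hw⟩
    have hD : D i = ⟨z, g, w, hw⟩ := Function.update_self ..
    have key : ∃! h : y i ⟶ (D i).1, (ξ i).map h = (D i).2.2.1 ∧ f i ≫ h = (D i).2.1 := by
      refine existsUnique_apply
        (P := fun k (h : y k ⟶ (D k).1) => (ξ k).map h = (D k).2.2.1 ∧ f k ≫ h = (D k).2.1) ?_ i
      obtain ⟨h, ⟨h₁, h₂⟩, hu⟩ := H (e'' := fun k => (D k).1) (fun k => (D k).2.1)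
        (fun k => (D k).2.2.1) (funext fun k => (D k).2.2.2)
      exact ⟨h, fun k => ⟨congrFun h₁ k, congrFun h₂ k⟩,
        fun h' hh => hu h' ⟨funext fun k => (hh k).1, funext fun k => (hh k).2⟩⟩
    rwa [hD] at key
  · intro H z g w hw
    choose h hh hu using fun i => H i (g i) (w i) (congrFun hw i)
    exact ⟨h, ⟨funext fun i => (hh i).1, funext fun i => (hh i).2⟩,
      fun h' hh' => funext fun i => hu i _ ⟨congrFun hh'.1 i, congrFun hh'.2 i⟩⟩

theorem isCartesianMor_pi_iff {π : ∀ i, E i ⥤ B i} {x y : ∀ i, E i} {f : x ⟶ y} :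
    IsCartesianMor (Functor.pi π) f ↔ ∀ i, IsCartesianMor (π i) (f i) := by
  classical
  constructor
  · intro H i z g w hw
    let T (k : I) := Σ' (z : E k) (g : z ⟶ y k) (w : (π k).obj z ⟶ (π k).obj (x k)),
      w ≫ (π k).map (f k) = (π k).map g
    let D : ∀ k, T k :=
      Function.update (fun k => ⟨x k, f k, 𝟙 _, Category.id_comp _⟩) i ⟨z, g, w, hw⟩
    have hD : D i = ⟨z, g, w, hw⟩ := Function.update_self ..
    have key : ∃! h : (D i).1 ⟶ x i, (π i).map h = (D i).2.2.1 ∧ h ≫ f i = (D i).2.1 := by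
      refine existsUnique_apply
        (P := fun k (h : (D k).1 ⟶ x k) => (π k).map h = (D k).2.2.1 ∧ h ≫ f k = (D k).2.1) ?_ i
      obtain ⟨h, ⟨h₁, h₂⟩, hu⟩ := H (e'' := fun k => (D k).1) (fun k => (D k).2.1)
        (fun k => (D k).2.2.1) (funext fun k => (D k).2.2.2)
      exact ⟨h, fun k => ⟨congrFun h₁ k, congrFun h₂ k⟩,
        fun h' hh => hu h' ⟨funext fun k => (hh k).1, funext fun k => (hh k).2⟩⟩
    rwa [hD] at key
  · intro H z g w hw
    choose h hh hu using fun i => H i (g i) (w i) (congrFun hw i)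
    exact ⟨h, ⟨funext fun i => (hh i).1, funext fun i => (hh i).2⟩,
      fun h' hh' => funext fun i => hu i _ ⟨congrFun hh'.1 i, congrFun hh'.2 i⟩⟩

theorem CocartOnLeft.pi {ξ : ∀ i, E i ⥤ A i} {π : ∀ i, E i ⥤ B i}
    (H : ∀ i, CocartOnLeft (ξ i) (π i)) : CocartOnLeft (Functor.pi ξ) (Functor.pi π) := by
  intro e a' u
  choose e' f ha hf hv hu using fun i => H i (e i) (u i)
  refine ⟨e', f, funext ha, isOpcartesianMor_pi_iff.2 hf, isVerticalMor_pi_iff.2 hv,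
    funext fun i => ?_⟩
  rw [Pi.comp_apply, Functor.eqToHom_proj]
  exact hu i

theorem CartOnRight.pi {ξ : ∀ i, E i ⥤ A i} {π : ∀ i, E i ⥤ B i}
    (H : ∀ i, CartOnRight (ξ i) (π i)) : CartOnRight (Functor.pi ξ) (Functor.pi π) := by
  intro e b' v
  choose e' f hb hf hv hu using fun i => H i (e i) (v i)
  refine ⟨e', f, funext hb, isCartesianMor_pi_iff.2 hf, isVerticalMor_pi_iff.2 hv,
    funext fun i => ?_⟩
  rw [Pi.comp_apply, Functor.eqToHom_proj]
  exact hu i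

theorem LiftsCommute.pi {ξ : ∀ i, E i ⥤ A i} {π : ∀ i, E i ⥤ B i}
    (H : ∀ i, LiftsCommute (ξ i) (π i)) : LiftsCommute (Functor.pi ξ) (Functor.pi π) := by
  intro e e₁ e₂ e₃ e₄ k k' f f' g h hk hkv hk' hkv' hf hfv hfk hf' hfv' hfk' hg hfg hh hhv hhg
  rw [isOpcartesianMor_pi_iff] at hk hf
  rw [isCartesianMor_pi_iff] at hk' hf'
  rw [isVerticalMor_pi_iff] at hkv hkv' hfv hfv' hg hh hhv
  exact (isIso_pi_iff h).2 fun i =>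
    H i (k i) (k' i) (f i) (f' i) (g i) (h i) (hk i) (hkv i) (hk' i) (hkv' i) (hf i) (hfv i)
      (hfk.apply i) (hf' i) (hfv' i) (hfk'.apply i) (hg i) (congrFun hfg i) (hh i) (hhv i)
      (congrFun hhg i)

/-- **Product stability of two-sided fibrations.** If each `⟨ξ i, π i⟩ : E i ⥤ A i × B i`
is a two-sided fibration, then the product span is a two-sided fibration over
`(∏ᵢ Aᵢ) × (∏ᵢ Bᵢ)`, and each evaluation projection, together with the projections
of the base products, is a two-sided cartesian functor. -/
theorem isTwoSidedFib_pi
    (ξ : ∀ i, E i ⥤ A i) (π : ∀ i, E i ⥤ B i)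
    (h2s : ∀ i, IsTwoSidedFib (ξ i) (π i)) :
    IsTwoSidedFib (Functor.pi ξ) (Functor.pi π) ∧
    (∀ j : I,
      IsTwoSidedCartFunctor (Functor.pi ξ) (Functor.pi π) (ξ j) (π j)
        (Pi.eval A j) (Pi.eval B j) (Pi.eval E j)) := by
  refine ⟨⟨.pi fun i => (h2s i).1, .pi fun i => (h2s i).2.1, .pi fun i => (h2s i).2.2⟩,
    fun j => ⟨rfl, rfl, fun _ _ _ hf => isOpcartesianMor_pi_iff.1 hf j,
      fun _ _ _ hf => isCartesianMor_pi_iff.1 hf j⟩⟩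

end Statement14
end
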